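/- Suppose the high temperature condition holds with parameters q ∈ [0,1) and K > 0, and let v = v(g,σ) and w = w(g,σ) be bounded functions of the disorder and the configuration. Then there exists a constant C depending only on β, h, K such that E( (1/N) Σ_{j=1}^N ⟨σ_j v⟩ ⟨σ_j w⟩ - q ⟨v⟩ ⟨w⟩ )² ≤ C ( E ⟨v⁴⟩ ⟨w⁴⟩ )^{1/2} / N, and moreover E( (1/N) Σ_{j=1}^N ⟨σ̇_j v⟩ ⟨σ_j w⟩ )² ≤ C ( E ⟨v⁴⟩ ⟨w⁴⟩ )^{1/2} / N. -/

import Mathlib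

open MeasureTheory ProbabilityTheory Real Finset

namespace SK

/-- Index set of pairs `i < j` in `Fin N`. -/
abbrev Pairs (N : ℕ) := {p : Fin N × Fin N // p.1 < p.2}

/-- The disorder: one real coordinate per pair. -/
abbrev Disorder (N : ℕ) := Pairs N → ℝ

/-- Law of the disorder: i.i.d. standard Gaussians. -/
noncomputable def μdis (N : ℕ) : Measure (Disorder N) :=
  Measure.pi fun _ => gaussianReal 0 1

/-- The symmetric extension `g_{ij}` of the disorder. -/
noncomputable def gval {N : ℕ} (G : Disorder N) (i j : Fin N) : ℝ :=
  if hij : i < j then G ⟨(i, j), hij⟩ else if hji : j < i then G ⟨(j, i), hji⟩ else 0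

abbrev Config (N : ℕ) := Fin N → Bool

/-- Spins `±1`. -/
def spin (b : Bool) : ℝ := if b then 1 else -1

/-- (Negative) Hamiltonian of the SK model. -/
noncomputable def ham {N : ℕ} (β h : ℝ) (G : Disorder N) (σ : Config N) : ℝ :=
  (β / Real.sqrt N) * ∑ p : Pairs N, G p * spin (σ p.1.1) * spin (σ p.1.2)
    + h * ∑ i, spin (σ i)

/-- Partition function. -/
noncomputable def Zpart {N : ℕ} (β h : ℝ) (G : Disorder N) : ℝ :=
  ∑ σ : Config N, Real.exp (ham β h G σ)

/-- Gibbs measure. -/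
noncomputable def gibbs {N : ℕ} (β h : ℝ) (G : Disorder N) (σ : Config N) : ℝ :=
  Real.exp (ham β h G σ) / Zpart β h G

/-- Quenched average of a function of one replica. -/
noncomputable def qavg {N : ℕ} (β h : ℝ) (G : Disorder N) (f : Config N → ℝ) : ℝ :=
  ∑ σ : Config N, f σ * gibbs β h G σ

/-- Quenched average of a function of two replicas. -/
noncomputable def qavg2 {N : ℕ} (β h : ℝ) (G : Disorder N)
    (f : Config N → Config N → ℝ) : ℝ :=
  ∑ σ1 : Config N, ∑ σ2 : Config N, f σ1 σ2 * gibbs β h G σ1 * gibbs β h G σ2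

/-- Overlap of two configurations. -/
noncomputable def overlap {N : ℕ} (σ1 σ2 : Config N) : ℝ :=
  (1 / (N : ℝ)) * ∑ i, spin (σ1 i) * spin (σ2 i)

/-- The high temperature condition `E⟨(R₁₂ - q)⁴⟩ ≤ K/N²`. -/
def highTemp (N : ℕ) (β h q K : ℝ) : Prop :=
  ∫ G, qavg2 β h G (fun σ1 σ2 => (overlap σ1 σ2 - q) ^ 4) ∂(μdis N) ≤ K / (N : ℝ) ^ 2

/-- Magnetization `⟨σ_i⟩`. -/
noncomputable def mavg {N : ℕ} (β h : ℝ) (G : Disorder N) (i : Fin N) : ℝ :=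
  qavg β h G fun σ => spin (σ i)

/-- Local field `ℓ_i`. -/
noncomputable def locField {N : ℕ} (G : Disorder N) (i : Fin N) (σ : Config N) : ℝ :=
  (1 / Real.sqrt N) * ∑ j ∈ Finset.univ.erase i, gval G i j * spin (σ j)

/-- The field `r_i`. -/
noncomputable def rfield {N : ℕ} (β h q : ℝ) (G : Disorder N) (i : Fin N) : ℝ :=
  (1 / Real.sqrt N) * ∑ j ∈ Finset.univ.erase i, gval G i j * mavg β h G j
    - β * (1 - q) * mavg β h G i

/-- Gaussian density `φ_{μ,v}` with mean `μ` and variance `v`. -/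
noncomputable def gaussDens (μ v x : ℝ) : ℝ :=
  (1 / (Real.sqrt (2 * π) * Real.sqrt v)) * Real.exp (-(x - μ) ^ 2 / (2 * v))

/-- Mixture-Gaussian density `ψ_{a,b,μ,v}`. -/
noncomputable def mixDens (a b μ v x : ℝ) : ℝ :=
  Real.cosh (a * x + b) * Real.exp (-(x - μ) ^ 2 / (2 * v)) /
    (Real.sqrt (2 * π) * Real.sqrt v * Real.cosh (a * μ + b) * Real.exp (a ^ 2 * v / 2))


lemma Zpart_pos {N : ℕ} (β h : ℝ) (G : Disorder N) : 0 < Zpart β h G :=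
  Finset.sum_pos (fun _ _ => Real.exp_pos _) Finset.univ_nonempty

lemma gibbs_nonneg {N : ℕ} (β h : ℝ) (G : Disorder N) (σ : Config N) : 0 ≤ gibbs β h G σ :=
  div_nonneg (Real.exp_pos _).le (Zpart_pos β h G).le

lemma sum_gibbs {N : ℕ} (β h : ℝ) (G : Disorder N) : ∑ σ, gibbs β h G σ = 1 := by
  simp only [gibbs, ← Finset.sum_div]
  exact div_self (Zpart_pos β h G).ne'

lemma measurable_gibbs {N : ℕ} (β h : ℝ) (σ : Config N) :
    Measurable fun G : Disorder N => gibbs β h G σ := by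
  unfold gibbs Zpart ham
  fun_prop

lemma qavg_sq_le {N : ℕ} (β h : ℝ) (G : Disorder N) (f : Config N → ℝ) :
    qavg β h G f ^ 2 ≤ qavg β h G fun σ => f σ ^ 2 := by
  have key := Finset.sum_sq_le_sum_mul_sum_of_sq_le_mul Finset.univ
    (r := fun σ => f σ * gibbs β h G σ) (f := fun σ => f σ ^ 2 * gibbs β h G σ)
    (g := fun σ => gibbs β h G σ)
    (fun σ _ => mul_nonneg (sq_nonneg _) (gibbs_nonneg β h G σ))
    (fun σ _ => gibbs_nonneg β h G σ) (fun σ _ => le_of_eq (by ring))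
  rwa [sum_gibbs, mul_one] at key

lemma qavg_nonneg {N : ℕ} (β h : ℝ) (G : Disorder N) {f : Config N → ℝ} (hf : ∀ σ, 0 ≤ f σ) :
    0 ≤ qavg β h G f :=
  Finset.sum_nonneg fun σ _ => mul_nonneg (hf σ) (gibbs_nonneg β h G σ)

lemma qavg_le {N : ℕ} (β h : ℝ) (G : Disorder N) {f : Config N → ℝ} {M : ℝ}
    (hf : ∀ σ, f σ ≤ M) : qavg β h G f ≤ M := by
  calc qavg β h G f ≤ ∑ σ, M * gibbs β h G σ :=
        Finset.sum_le_sum fun σ _ => mul_le_mul_of_nonneg_right (hf σ) (gibbs_nonneg β h G σ)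
    _ = M := by rw [← Finset.mul_sum, sum_gibbs, mul_one]

lemma measurable_qavg {N : ℕ} (β h : ℝ) {f : Disorder N → Config N → ℝ}
    (hf : ∀ σ, Measurable fun G => f G σ) : Measurable fun G => qavg β h G (f G) :=
  Finset.measurable_sum _ fun σ _ => (hf σ).mul (measurable_gibbs β h σ)

lemma qavg2_eq_qavg_qavg {N : ℕ} (β h : ℝ) (G : Disorder N) (f : Config N → Config N → ℝ) :
    qavg2 β h G f = qavg β h G fun σ => qavg β h G (f σ) := by
  simp only [qavg2, qavg, Finset.sum_mul]
  exact Finset.sum_congr rfl fun _ _ => Finset.sum_congr rfl fun _ _ => by ring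

lemma qavg2_sq_le {N : ℕ} (β h : ℝ) (G : Disorder N) (f : Config N → Config N → ℝ) :
    qavg2 β h G f ^ 2 ≤ qavg2 β h G fun σ τ => f σ τ ^ 2 := by
  simp only [qavg2_eq_qavg_qavg]
  exact (qavg_sq_le β h G _).trans <| Finset.sum_le_sum fun σ _ =>
    mul_le_mul_of_nonneg_right (qavg_sq_le β h G _) (gibbs_nonneg β h G σ)

/-- Cauchy–Schwarz for two replicas. -/
lemma qavg2_mul_sq_le {N : ℕ} (β h : ℝ) (G : Disorder N) (f : Config N → Config N → ℝ)
    (v w : Config N → ℝ) :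
    qavg2 β h G (fun σ τ => f σ τ * (v σ * w τ)) ^ 2 ≤
      qavg2 β h G (fun σ τ => f σ τ ^ 2) *
        (qavg β h G (fun σ => v σ ^ 2) * qavg β h G (fun σ => w σ ^ 2)) := by
  have hg := gibbs_nonneg β h G
  have key := Finset.sum_sq_le_sum_mul_sum_of_sq_le_mul Finset.univ
    (r := fun p : Config N × Config N =>
      f p.1 p.2 * (v p.1 * w p.2) * gibbs β h G p.1 * gibbs β h G p.2)
    (f := fun p => f p.1 p.2 ^ 2 * gibbs β h G p.1 * gibbs β h G p.2)
    (g := fun p => v p.1 ^ 2 * gibbs β h G p.1 * (w p.2 ^ 2 * gibbs β h G p.2))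
    (fun p _ => mul_nonneg (mul_nonneg (sq_nonneg _) (hg _)) (hg _))
    (fun p _ => mul_nonneg (mul_nonneg (sq_nonneg _) (hg _)) (mul_nonneg (sq_nonneg _) (hg _)))
    (fun p _ => le_of_eq (by ring))
  simp only [Fintype.sum_prod_type] at key
  simpa only [qavg2, qavg, Finset.sum_mul_sum] using key

lemma qavg2_overlap_sub {N : ℕ} (β h q : ℝ) (G : Disorder N) (v w : Config N → ℝ) :
    qavg2 β h G (fun σ τ => (overlap σ τ - q) * (v σ * w τ)) =
      (1 / (N : ℝ)) * ∑ j : Fin N, qavg β h G (fun σ => spin (σ j) * v σ)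
          * qavg β h G (fun σ => spin (σ j) * w σ)
        - q * qavg β h G v * qavg β h G w := by
  have swap : ∑ j : Fin N, qavg β h G (fun σ => spin (σ j) * v σ)
      * qavg β h G (fun σ => spin (σ j) * w σ) =
      ∑ σ, ∑ τ, (∑ j : Fin N, spin (σ j) * spin (τ j)) *
        (v σ * w τ * gibbs β h G σ * gibbs β h G τ) := by
    simp only [qavg, Finset.sum_mul_sum]
    rw [Finset.sum_comm]
    refine Finset.sum_congr rfl fun σ _ => ?_
    rw [Finset.sum_comm]
    refine Finset.sum_congr rfl fun τ _ => ?_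
    rw [Finset.sum_mul]
    exact Finset.sum_congr rfl fun _ _ => by ring
  rw [swap]
  rw [mul_assoc q, qavg, qavg, Finset.sum_mul_sum]
  simp only [qavg2, overlap, Finset.mul_sum (univ : Finset (Config N)),
    ← Finset.sum_sub_distrib]
  exact Finset.sum_congr rfl fun σ _ => Finset.sum_congr rfl fun τ _ => by ring

lemma overlap_product_sq_le {N : ℕ} (β h q : ℝ) (G : Disorder N) (v w : Config N → ℝ) :
    ((1 / (N : ℝ)) * ∑ j : Fin N, qavg β h G (fun σ => spin (σ j) * v σ)
          * qavg β h G (fun σ => spin (σ j) * w σ)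
        - q * qavg β h G v * qavg β h G w) ^ 2 ≤
      qavg2 β h G (fun σ τ => (overlap σ τ - q) ^ 2) *
        (qavg β h G (fun σ => v σ ^ 2) * qavg β h G (fun σ => w σ ^ 2)) := by
  rw [← qavg2_overlap_sub]
  exact qavg2_mul_sq_le β h G (fun σ τ => overlap σ τ - q) v w

lemma centered_overlap_product_sq_le {N : ℕ} (β h q : ℝ) (G : Disorder N)
    (v w : Config N → ℝ) :
    ((1 / (N : ℝ)) * ∑ j : Fin N, qavg β h G (fun σ => (spin (σ j) - mavg β h G j) * v σ)
          * qavg β h G (fun σ => spin (σ j) * w σ)) ^ 2 ≤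
      4 * (qavg2 β h G (fun σ τ => (overlap σ τ - q) ^ 2) *
        (qavg β h G (fun σ => v σ ^ 2) * qavg β h G (fun σ => w σ ^ 2))) := by
  have h₁ := overlap_product_sq_le β h q G v w
  have h₂ := overlap_product_sq_le β h q G (fun _ => 1) w
  have one : qavg β h G (fun _ => 1) = 1 := by simp [qavg, sum_gibbs]
  have e : ∀ j, qavg β h G (fun σ => (spin (σ j) - mavg β h G j) * v σ) =
      qavg β h G (fun σ => spin (σ j) * v σ) - qavg β h G v * mavg β h G j := by
    intro j
    simp only [qavg, sub_mul, Finset.sum_sub_distrib, Finset.sum_mul]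
    congr 1
    exact Finset.sum_congr rfl fun _ _ => by ring
  simp only [one_pow, mul_one, one, one_mul] at h₂
  simp only [e]
  simp only [sub_mul, Finset.sum_sub_distrib, mul_assoc, ← Finset.mul_sum]
  simp only [mul_assoc] at h₁
  change ((1 / (N : ℝ)) * ∑ j : Fin N, mavg β h G j * _ - _) ^ 2 ≤ _ at h₂
  set S := ∑ j : Fin N, mavg β h G j * qavg β h G (fun σ => spin (σ j) * w σ)
  set T := ∑ j : Fin N, qavg β h G (fun σ => spin (σ j) * v σ) *
    qavg β h G (fun σ => spin (σ j) * w σ)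
  have h₃ : qavg β h G v ^ 2 * ((1 / (N : ℝ)) * S - q * qavg β h G w) ^ 2 ≤
      qavg β h G (fun σ => v σ ^ 2) * (qavg2 β h G (fun σ τ => (overlap σ τ - q) ^ 2) *
        qavg β h G (fun σ => w σ ^ 2)) :=
    mul_le_mul (qavg_sq_le β h G v) h₂ (sq_nonneg _)
      (qavg_nonneg β h G fun _ => sq_nonneg _)
  linarith [sq_nonneg ((1 / (N : ℝ)) * T - q * (qavg β h G v * qavg β h G w)
    + qavg β h G v * ((1 / (N : ℝ)) * S - q * qavg β h G w))]

instance (N : ℕ) : IsProbabilityMeasure (μdis N) := by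
  unfold μdis
  infer_instance

/-- If `Y ≤ c * A * B` pointwise with `A ^ 2 ≤ P` and `B ^ 2 ≤ Q`, then
`∫ Y ≤ c * √(∫ P) * √(∫ Q)`. -/
lemma integral_le_sqrt_mul_sqrt {Ω : Type*} [MeasurableSpace Ω] {μ : Measure Ω}
    {Y A B P Q : Ω → ℝ} {c : ℝ} (hc : 0 ≤ c)
    (hP : Integrable P μ) (hQ : Integrable Q μ) (hY : ∀ x, 0 ≤ Y x)
    (hYAB : ∀ x, Y x ≤ c * (A x * B x)) (hAP : ∀ x, A x ^ 2 ≤ P x) (hBQ : ∀ x, B x ^ 2 ≤ Q x) :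
    ∫ x, Y x ∂μ ≤ c * (√(∫ x, P x ∂μ) * √(∫ x, Q x ∂μ)) := by
  have hP0 : ∀ x, 0 ≤ P x := fun x => (sq_nonneg _).trans (hAP x)
  have hQ0 : ∀ x, 0 ≤ Q x := fun x => (sq_nonneg _).trans (hBQ x)
  have memLp_sqrt : ∀ {F : Ω → ℝ}, Integrable F μ → (∀ x, 0 ≤ F x) →
      MemLp (fun x => √(F x)) 2 μ := fun hF hF0 =>
    (memLp_two_iff_integrable_sq
      (Real.continuous_sqrt.comp_aestronglyMeasurable hF.aestronglyMeasurable)).2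
      (by simpa only [Real.sq_sqrt (hF0 _)] using hF)
  have hP2 := memLp_sqrt hP hP0
  have hQ2 := memLp_sqrt hQ hQ0
  have hint : Integrable (fun x => √(P x) * √(Q x)) μ := hP2.integrable_mul hQ2
  have hCS := integral_mul_le_Lp_mul_Lq_of_nonneg (μ := μ) Real.HolderConjugate.two_two
    (Filter.Eventually.of_forall fun x => Real.sqrt_nonneg (P x))
    (Filter.Eventually.of_forall fun x => Real.sqrt_nonneg (Q x))
    (by simpa using hP2) (by simpa using hQ2)
  simp only [Real.rpow_two, Real.sq_sqrt (hP0 _), Real.sq_sqrt (hQ0 _),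
    ← Real.sqrt_eq_rpow] at hCS
  calc ∫ x, Y x ∂μ ≤ ∫ x, c * (√(P x) * √(Q x)) ∂μ :=
        integral_mono_of_nonneg (Filter.Eventually.of_forall hY) (hint.const_mul c)
          (Filter.Eventually.of_forall fun x => (hYAB x).trans <|
            mul_le_mul_of_nonneg_left (by
              rw [← Real.sqrt_mul (hP0 x)]
              apply Real.le_sqrt_of_sq_le
              rw [mul_pow]
              exact mul_le_mul (hAP x) (hBQ x) (sq_nonneg _) (hP0 x)) hc)
    _ = c * ∫ x, √(P x) * √(Q x) ∂μ := integral_const_mul _ _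
    _ ≤ _ := mul_le_mul_of_nonneg_left hCS hc

lemma integrable_qavg2_overlap {N : ℕ} (β h q : ℝ) :
    Integrable (fun G : Disorder N => qavg2 β h G fun σ τ => (overlap σ τ - q) ^ 4) (μdis N) := by
  simp only [qavg2_eq_qavg_qavg]
  have hM : ∀ σ τ : Config N, (overlap σ τ - q) ^ 4 ≤
      ∑ p : Config N × Config N, (overlap p.1 p.2 - q) ^ 4 := fun σ τ =>
    Finset.single_le_sum (f := fun p : Config N × Config N => (overlap p.1 p.2 - q) ^ 4)
      (fun _ _ => by positivity) (Finset.mem_univ (σ, τ))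
  have hmeas : Measurable fun G : Disorder N =>
      qavg β h G fun σ => qavg β h G fun τ => (overlap σ τ - q) ^ 4 :=
    measurable_qavg β h (f := fun G σ => qavg β h G fun τ => (overlap σ τ - q) ^ 4) fun σ =>
      measurable_qavg β h (f := fun _ τ => (overlap σ τ - q) ^ 4) fun _ => measurable_const
  refine Integrable.of_bound hmeas.aestronglyMeasurable
    (∑ p : Config N × Config N, (overlap p.1 p.2 - q) ^ 4) (Filter.Eventually.of_forall fun G => ?_)
  rw [Real.norm_of_nonneg (qavg_nonneg β h G fun σ => qavg_nonneg β h G fun τ => by positivity)]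
  exact qavg_le β h G fun σ => qavg_le β h G (hM σ)

lemma integrable_qavg_pow_mul_qavg_pow {N : ℕ} (β h : ℝ) {v w : Disorder N → Config N → ℝ}
    (hv : ∀ σ, Measurable fun G => v G σ) (hw : ∀ σ, Measurable fun G => w G σ) {M : ℝ}
    (hM : ∀ G σ, |v G σ| ≤ M ∧ |w G σ| ≤ M) :
    Integrable (fun G => qavg β h G (fun σ => v G σ ^ 4) * qavg β h G (fun σ => w G σ ^ 4))
      (μdis N) := by
  have pow_le : ∀ {x : ℝ}, |x| ≤ M → x ^ 4 ≤ M ^ 4 := fun {x} hx => by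
    have := pow_le_pow_left₀ (abs_nonneg x) hx 4
    rwa [Even.pow_abs (by decide)] at this
  have nonneg : ∀ G (f : Config N → ℝ), 0 ≤ qavg β h G fun σ => f σ ^ 4 := fun G f =>
    qavg_nonneg β h G fun σ => by positivity
  refine Integrable.of_bound ((measurable_qavg β h fun σ => (hv σ).pow_const 4).mul
    (measurable_qavg β h fun σ => (hw σ).pow_const 4)).aestronglyMeasurable (M ^ 4 * M ^ 4)
    (Filter.Eventually.of_forall fun G => ?_)
  rw [Real.norm_of_nonneg (mul_nonneg (nonneg G _) (nonneg G _))]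
  exact mul_le_mul (qavg_le β h G fun σ => pow_le (hM G σ).1)
    (qavg_le β h G fun σ => pow_le (hM G σ).2) (nonneg G _) (by positivity)

/-- Estimates (3.10) and (3.12). -/
theorem est_overlap_products (β h K : ℝ) (hβ : 0 < β) (hK : 0 < K) :
    ∃ C : ℝ, 0 < C ∧ ∀ (N : ℕ) (q : ℝ), 2 ≤ N → 0 ≤ q → q < 1 →
      highTemp N β h q K →
      ∀ v w : Disorder N → Config N → ℝ,
      (∀ σ, Measurable fun G => v G σ) → (∀ σ, Measurable fun G => w G σ) →
      (∃ M : ℝ, ∀ G σ, |v G σ| ≤ M ∧ |w G σ| ≤ M) →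
        (∫ G, ((1 / (N : ℝ)) * ∑ j : Fin N,
              qavg β h G (fun σ => spin (σ j) * v G σ)
                * qavg β h G (fun σ => spin (σ j) * w G σ)
            - q * qavg β h G (fun σ => v G σ)
                * qavg β h G (fun σ => w G σ)) ^ 2 ∂(μdis N)
          ≤ C * Real.sqrt (∫ G, qavg β h G (fun σ => v G σ ^ 4)
              * qavg β h G (fun σ => w G σ ^ 4) ∂(μdis N)) / N)
        ∧ (∫ G, ((1 / (N : ℝ)) * ∑ j : Fin N,
              qavg β h G (fun σ => (spin (σ j) - mavg β h G j) * v G σ)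
                * qavg β h G (fun σ => spin (σ j) * w G σ)) ^ 2 ∂(μdis N)
          ≤ C * Real.sqrt (∫ G, qavg β h G (fun σ => v G σ ^ 4)
              * qavg β h G (fun σ => w G σ ^ 4) ∂(μdis N)) / N) := by
  refine ⟨4 * √K, by positivity, fun N q _ _ _ hT v w hv hw ⟨M, hM⟩ => ?_⟩
  have pow_four : ∀ x : ℝ, x ^ 4 = (x ^ 2) ^ 2 := fun x => by ring
  have hsqrt : √(∫ G, qavg2 β h G (fun σ τ => (overlap σ τ - q) ^ 4) ∂(μdis N)) ≤ √K / N := by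
    refine (Real.sqrt_le_sqrt hT).trans_eq ?_
    rw [Real.sqrt_div hK.le, Real.sqrt_sq (Nat.cast_nonneg N)]
  have hA : ∀ G : Disorder N, qavg2 β h G (fun σ τ => (overlap σ τ - q) ^ 2) ^ 2 ≤
      qavg2 β h G (fun σ τ => (overlap σ τ - q) ^ 4) := fun G => by
    simpa only [pow_four] using qavg2_sq_le β h G fun σ τ => (overlap σ τ - q) ^ 2
  have hsq : ∀ (G : Disorder N) (f : Config N → ℝ), qavg β h G (fun σ => f σ ^ 2) ^ 2 ≤
      qavg β h G (fun σ => f σ ^ 4) := fun G f => by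
    simpa only [pow_four] using qavg_sq_le β h G fun σ => f σ ^ 2
  have hB : ∀ G, (qavg β h G (fun σ => v G σ ^ 2) * qavg β h G (fun σ => w G σ ^ 2)) ^ 2 ≤
      qavg β h G (fun σ => v G σ ^ 4) * qavg β h G (fun σ => w G σ ^ 4) := fun G => by
    rw [mul_pow]
    exact mul_le_mul (hsq G _) (hsq G _) (sq_nonneg _) ((sq_nonneg _).trans (hsq G _))
  have main : ∀ Y : Disorder N → ℝ, (∀ G, 0 ≤ Y G) →
      (∀ G, Y G ≤ 4 * (qavg2 β h G (fun σ τ => (overlap σ τ - q) ^ 2) *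
        (qavg β h G (fun σ => v G σ ^ 2) * qavg β h G (fun σ => w G σ ^ 2)))) →
      ∫ G, Y G ∂(μdis N) ≤ 4 * √K * √(∫ G, qavg β h G (fun σ => v G σ ^ 4)
        * qavg β h G (fun σ => w G σ ^ 4) ∂(μdis N)) / N := fun Y hY hYAB => by
    refine (integral_le_sqrt_mul_sqrt (by norm_num) (integrable_qavg2_overlap β h q)
      (integrable_qavg_pow_mul_qavg_pow β h hv hw hM) hY hYAB hA hB).trans ?_
    refine (mul_le_mul_of_nonneg_left
      (mul_le_mul_of_nonneg_right hsqrt (Real.sqrt_nonneg _)) (by norm_num)).trans_eq ?_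
    ring
  refine ⟨main _ (fun _ => sq_nonneg _) fun G => ?_, main _ (fun _ => sq_nonneg _) fun G =>
    centered_overlap_product_sq_le β h q G (v G) (w G)⟩
  have hX := overlap_product_sq_le β h q G (v G) (w G)
  exact hX.trans (le_mul_of_one_le_left ((sq_nonneg _).trans hX) (by norm_num))

end SK
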